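/- Let p ∈ [1,∞], let ε ≥ 0, let F₀ be a Borel probability distribution on Ξ = {−1,1}×ℝⁿ with finite p-th moment, and let (Y₀,X₀) ∼ F₀. Then the set of distributions { law of Y·X : the law of (Y,X) lies in B̄_p(F₀,ε) } is equal to the type-p Wasserstein ball B_p(law of Y₀·X₀, ε) of distributions on ℝⁿ. -/

import Mathlib

open MeasureTheory Set
open scoped ENNReal NNReal

noncomputable section

abbrev Vec (n : ℕ) := Fin n → ℝ

/-- `β^⊤x` -/
def dotp {n : ℕ} (β x : Vec n) : ℝ := ∑ i, β i * x i

/-- `nrm` is a norm on `ℝⁿ`. -/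
def IsNorm {n : ℕ} (nrm : Vec n → ℝ) : Prop :=
  (∀ x, nrm x = 0 ↔ x = 0) ∧
  (∀ (c : ℝ) (x : Vec n), nrm (c • x) = |c| * nrm x) ∧
  (∀ x y : Vec n, nrm (x + y) ≤ nrm x + nrm y)

/-- the dual norm `‖β‖_* = sup_{‖x‖ ≤ 1} β^⊤x`. -/
def dualNorm {n : ℕ} (nrm : Vec n → ℝ) (β : Vec n) : ℝ :=
  sSup {r | ∃ x, nrm x ≤ 1 ∧ r = dotp β x}

/-- Couplings of two probability measures. -/
def Couplings {E : Type*} [MeasurableSpace E] (μ ν : Measure E) : Set (Measure (E × E)) :=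
  {π | IsProbabilityMeasure π ∧ π.map Prod.fst = μ ∧ π.map Prod.snd = ν}

/-- The type-`p` Wasserstein distance (valued in `ℝ≥0∞`) associated with an
extended-real-valued cost; for `p = ∞` it is the infimum over couplings of the essential
supremum of the cost. -/
def WassersteinD {E : Type*} [MeasurableSpace E] (cost : E → E → ℝ≥0∞) (p : ℝ≥0∞)
    (μ ν : Measure E) : ℝ≥0∞ :=
  if p = ∞ then ⨅ π ∈ Couplings μ ν, essSup (fun z : E × E => cost z.1 z.2) π
  else ⨅ π ∈ Couplings μ ν, (∫⁻ z, cost z.1 z.2 ^ p.toReal ∂π) ^ (1 / p.toReal)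

/-- Finite `p`-th moment (with respect to a "norm-like" function `nrm`);
for `p = ∞` it means essential boundedness. -/
def HasMomentP {E : Type*} [MeasurableSpace E] (nrm : E → ℝ) (p : ℝ≥0∞) (μ : Measure E) : Prop :=
  if p = ∞ then essSup (fun x => ENNReal.ofReal (nrm x)) μ ≠ ∞
  else ∫⁻ x, ENNReal.ofReal (nrm x) ^ p.toReal ∂μ ≠ ∞

/-- The type-`p` Wasserstein ball of probability distributions on `ℝⁿ` (norm `nrm`). -/
def WballVec {n : ℕ} (nrm : Vec n → ℝ) (p : ℝ≥0∞) (μ₀ : Measure (Vec n)) (ε : ℝ) :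
    Set (Measure (Vec n)) :=
  {μ | IsProbabilityMeasure μ ∧ HasMomentP nrm p μ ∧
    WassersteinD (fun x y => ENNReal.ofReal (nrm (x - y))) p μ μ₀ ≤ ENNReal.ofReal ε}

/-- The type-`p` Wasserstein ball of probability distributions on `ℝ`
(absolute-value norm). -/
def WballReal (p : ℝ≥0∞) (μ₀ : Measure ℝ) (ε : ℝ) : Set (Measure ℝ) :=
  {μ | IsProbabilityMeasure μ ∧ HasMomentP (fun x : ℝ => |x|) p μ ∧
    WassersteinD (fun x y : ℝ => ENNReal.ofReal |x - y|) p μ μ₀ ≤ ENNReal.ofReal ε}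

/-- The metric on `Ξ = {-1,1} × ℝⁿ`:
`d((y₁,x₁),(y₂,x₂)) = ‖x₁ - x₂‖` if `y₁ = y₂`, and `+∞` otherwise. -/
def xiCost {n : ℕ} (nrm : Vec n → ℝ) (z₁ z₂ : ℝ × Vec n) : ℝ≥0∞ :=
  if z₁.1 = z₂.1 then ENNReal.ofReal (nrm (z₁.2 - z₂.2)) else ∞

/-- A measure on `ℝ × ℝⁿ` is concentrated on `Ξ = {-1,1} × ℝⁿ`. -/
def OnXi {n : ℕ} (μ : Measure (ℝ × Vec n)) : Prop :=
  μ {z | z.1 = 1 ∨ z.1 = -1} = 1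

/-- The type-`p` Wasserstein ball `B̄_p(F₀,ε)` of probability distributions on
`Ξ = {-1,1} × ℝⁿ`. -/
def WballXi {n : ℕ} (nrm : Vec n → ℝ) (p : ℝ≥0∞) (μ₀ : Measure (ℝ × Vec n)) (ε : ℝ) :
    Set (Measure (ℝ × Vec n)) :=
  {μ | IsProbabilityMeasure μ ∧ OnXi μ ∧ HasMomentP (fun z => nrm z.2) p μ ∧
    WassersteinD (xiCost nrm) p μ μ₀ ≤ ENNReal.ofReal ε}

open ProbabilityTheory BoundedContinuousFunction

/-- Integration of a fixed continuous `ℝ≥0∞`-valued function is weakly lower semicontinuous. -/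
lemma lowerSemicontinuous_lintegral_of_continuous {Ω : Type*} [TopologicalSpace Ω]
    [MeasurableSpace Ω] [OpensMeasurableSpace Ω] {f : Ω → ℝ≥0∞} (hf : Continuous f) :
    LowerSemicontinuous fun μ : ProbabilityMeasure Ω ↦ ∫⁻ x, f x ∂(μ : Measure Ω) := by
  have hcont (k : ℕ) : Continuous fun x ↦ (min (f x) k).toNNReal :=
    ENNReal.continuousOn_toNNReal.comp_continuous (hf.min continuous_const)
      fun x ↦ ((min_le_right _ _).trans_lt (ENNReal.natCast_lt_top k)).ne
  have hcoe (k : ℕ) (x : Ω) : ((min (f x) k).toNNReal : ℝ≥0∞) = min (f x) k :=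
    ENNReal.coe_toNNReal ((min_le_right _ _).trans_lt (ENNReal.natCast_lt_top k)).ne
  let g (k : ℕ) : Ω →ᵇ ℝ≥0 := BoundedContinuousFunction.mkOfBound ⟨_, hcont k⟩ k (by
    have hle (x : Ω) : (min (f x) k).toNNReal ≤ k := by
      rw [← ENNReal.coe_le_coe, hcoe]
      exact_mod_cast min_le_right _ _
    intro x y
    rw [NNReal.dist_eq, abs_le]
    have hx : ((min (f x) k).toNNReal : ℝ) ≤ k := by exact_mod_cast hle x
    have hy : ((min (f y) k).toNNReal : ℝ) ≤ k := by exact_mod_cast hle y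
    have hx0 := (min (f x) k).toNNReal.coe_nonneg
    have hy0 := (min (f y) k).toNNReal.coe_nonneg
    simp only [ContinuousMap.coe_mk]
    constructor <;> linarith)
  have hsup (x : Ω) : f x = ⨆ k : ℕ, (g k x : ℝ≥0∞) := by
    have : ∀ k : ℕ, (g k x : ℝ≥0∞) = f x ⊓ (k : ℝ≥0∞) := fun k ↦ hcoe k x
    simp_rw [this, ← inf_iSup_eq, ENNReal.iSup_natCast, inf_top_eq]
  have hlint (μ : ProbabilityMeasure Ω) :
      ∫⁻ x, f x ∂(μ : Measure Ω) = ⨆ k : ℕ, ∫⁻ x, (g k x : ℝ≥0∞) ∂(μ : Measure Ω) := by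
    simp_rw [hsup]
    refine lintegral_iSup (fun k ↦ ((g k).continuous.measurable).coe_nnreal_ennreal) ?_
    intro i j hij x
    change ((min (f x) i).toNNReal : ℝ≥0∞) ≤ ((min (f x) j).toNNReal : ℝ≥0∞)
    rw [hcoe, hcoe]
    gcongr
  simp_rw [hlint]
  exact lowerSemicontinuous_iSup fun k ↦
    (ProbabilityMeasure.continuous_lintegral_boundedContinuousFunction (g k)).lowerSemicontinuous

lemma lowerSemicontinuous_eLpNorm_of_continuous {Ω : Type*} [TopologicalSpace Ω]
    [MeasurableSpace Ω] [OpensMeasurableSpace Ω] {f : Ω → ℝ≥0∞} (hf : Continuous f) {p : ℝ≥0∞}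
    (hp : p ≠ 0) :
    LowerSemicontinuous fun μ : ProbabilityMeasure Ω ↦ eLpNorm f p (μ : Measure Ω) := by
  by_cases hp_top : p = ∞
  · subst hp_top
    rw [lowerSemicontinuous_iff_isClosed_preimage]
    intro a
    have hset : (fun μ : ProbabilityMeasure Ω ↦ eLpNorm f ∞ (μ : Measure Ω)) ⁻¹' Iic a =
        (fun μ : ProbabilityMeasure Ω ↦ ∫⁻ x, (f x - a) ∂(μ : Measure Ω)) ⁻¹' Iic 0 := by
      ext μ
      have hmeas : Measurable fun x ↦ f x - a := hf.measurable.sub_const a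
      simp only [mem_preimage, mem_Iic, nonpos_iff_eq_zero, lintegral_eq_zero_iff hmeas,
        eLpNorm_exponent_top, eLpNormEssSup, enorm_eq_self]
      constructor
      · intro h
        filter_upwards [ENNReal.ae_le_essSup (μ := (μ : Measure Ω)) f] with x hx
        simpa using tsub_eq_zero_of_le (hx.trans h)
      · intro h
        refine essSup_le_of_ae_le a ?_
        filter_upwards [h] with x hx
        simpa [tsub_eq_zero_iff_le] using hx
    rw [hset]
    exact (lowerSemicontinuous_lintegral_of_continuous
      ((ENNReal.continuous_sub_right a).comp hf)).isClosed_preimage 0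
  · simp_rw [eLpNorm_eq_lintegral_rpow_enorm_toReal hp hp_top, enorm_eq_self]
    exact (ENNReal.continuous_rpow_const (y := 1 / p.toReal)).comp_lowerSemicontinuous
      (lowerSemicontinuous_lintegral_of_continuous
        ((ENNReal.continuous_rpow_const (y := p.toReal)).comp hf))
      (ENNReal.monotone_rpow_of_nonneg (by positivity))

lemma isCompact_couplings {E : Type*} [TopologicalSpace E] [PolishSpace E]
    [MeasurableSpace E] [BorelSpace E] (μ ν : ProbabilityMeasure E) :
    IsCompact {π : ProbabilityMeasure (E × E) | (π : Measure (E × E)) ∈ Couplings μ ν} := by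
  have hset : {π : ProbabilityMeasure (E × E) | (π : Measure (E × E)) ∈ Couplings μ ν} =
      {π | π.map continuous_fst.measurable.aemeasurable = μ} ∩
        {π | π.map continuous_snd.measurable.aemeasurable = ν} := by
    ext π
    constructor
    · rintro ⟨-, h₁, h₂⟩
      exact ⟨Subtype.ext h₁, Subtype.ext h₂⟩
    · rintro ⟨h₁, h₂⟩
      exact ⟨π.2, congrArg Subtype.val h₁, congrArg Subtype.val h₂⟩
  have hclosed :
      IsClosed {π : ProbabilityMeasure (E × E) | (π : Measure (E × E)) ∈ Couplings μ ν} := by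
    rw [hset]
    exact (isClosed_eq (ProbabilityMeasure.continuous_map continuous_fst) continuous_const).inter
      (isClosed_eq (ProbabilityMeasure.continuous_map continuous_snd) continuous_const)
  rw [← hclosed.closure_eq]
  apply isCompact_closure_of_isTightMeasureSet
  rw [isTightMeasureSet_iff_exists_isCompact_measure_compl_le]
  intro δ hδ
  have htight (μ : ProbabilityMeasure E) :
      ∃ K : Set E, IsCompact K ∧ (μ : Measure E) Kᶜ ≤ δ / 2 := by
    obtain ⟨K, hK, h⟩ := isTightMeasureSet_iff_exists_isCompact_measure_compl_le.1
      (isTightMeasureSet_singleton (μ := (μ : Measure E))) (δ / 2) (ENNReal.half_pos hδ.ne')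
    exact ⟨K, hK, h _ rfl⟩
  obtain ⟨K, hK, hμK⟩ := htight μ
  obtain ⟨L, hL, hνL⟩ := htight ν
  refine ⟨K ×ˢ L, hK.prod hL, ?_⟩
  rintro _ ⟨π, ⟨-, h₁, h₂⟩, rfl⟩
  rw [← h₁, Measure.map_apply measurable_fst hK.measurableSet.compl] at hμK
  rw [← h₂, Measure.map_apply measurable_snd hL.measurableSet.compl] at hνL
  calc (π : Measure (E × E)) (K ×ˢ L)ᶜ
      ≤ (π : Measure (E × E)) (Prod.fst ⁻¹' Kᶜ ∪ Prod.snd ⁻¹' Lᶜ) := by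
        refine measure_mono fun z hz ↦ ?_
        simp only [mem_compl_iff, mem_prod, not_and_or] at hz
        exact hz
    _ ≤ δ / 2 + δ / 2 := (measure_union_le _ _).trans (add_le_add hμK hνL)
    _ = δ := ENNReal.add_halves δ

lemma WassersteinD_eq_iInf_eLpNorm {E : Type*} [MeasurableSpace E] (cost : E → E → ℝ≥0∞)
    {p : ℝ≥0∞} (hp : p ≠ 0) (μ ν : Measure E) :
    WassersteinD cost p μ ν =
      ⨅ π ∈ Couplings μ ν, eLpNorm (fun z : E × E ↦ cost z.1 z.2) p π := by
  unfold WassersteinD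
  split_ifs with h
  · simp [h, eLpNormEssSup]
  · simp [eLpNorm_eq_lintegral_rpow_enorm_toReal hp h]

lemma hasMomentP_iff_eLpNorm_ne_top {E : Type*} [MeasurableSpace E] (nrm : E → ℝ)
    {p : ℝ≥0∞} (hp : p ≠ 0) (μ : Measure E) :
    HasMomentP nrm p μ ↔ eLpNorm (fun x ↦ ENNReal.ofReal (nrm x)) p μ ≠ ∞ := by
  unfold HasMomentP
  split_ifs with h
  · simp [h, eLpNormEssSup]
  · have : 0 < p.toReal := ENNReal.toReal_pos hp h
    simp [eLpNorm_eq_lintegral_rpow_enorm_toReal hp h, ENNReal.rpow_eq_top_iff, this, this.not_gt]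

/-- Optimal couplings exist for continuous costs on Polish spaces. -/
lemma exists_mem_couplings_eLpNorm_eq_WassersteinD {E : Type*} [TopologicalSpace E]
    [PolishSpace E] [MeasurableSpace E] [BorelSpace E] {cost : E → E → ℝ≥0∞}
    (hcost : Continuous fun z : E × E ↦ cost z.1 z.2) {p : ℝ≥0∞} (hp : p ≠ 0)
    (μ ν : Measure E) [IsProbabilityMeasure μ] [IsProbabilityMeasure ν] :
    ∃ π ∈ Couplings μ ν,
      eLpNorm (fun z : E × E ↦ cost z.1 z.2) p π = WassersteinD cost p μ ν := by
  have hne : {π : ProbabilityMeasure (E × E) | (π : Measure (E × E)) ∈ Couplings μ ν}.Nonempty :=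
    ⟨⟨μ.prod ν, inferInstance⟩, inferInstanceAs (IsProbabilityMeasure (μ.prod ν)), by simp, by simp⟩
  obtain ⟨π, hπ, hmin⟩ := LowerSemicontinuousOn.exists_isMinOn hne
    (isCompact_couplings ⟨μ, inferInstance⟩ ⟨ν, inferInstance⟩)
    ((lowerSemicontinuous_eLpNorm_of_continuous hcost hp).lowerSemicontinuousOn _)
  refine ⟨π, hπ, ?_⟩
  rw [WassersteinD_eq_iInf_eLpNorm cost hp]
  refine le_antisymm (le_iInf₂ fun π' hπ' ↦ ?_) (iInf₂_le (π : Measure (E × E)) hπ)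
  exact isMinOn_iff.1 hmin ⟨π', hπ'.1⟩ hπ'

/-- Gluing: a joint law whose first marginal is the law of `T` under `μ` can be lifted along `T`. -/
lemma exists_map_prodMap_eq {α β γ : Type*} [MeasurableSpace α] [MeasurableSpace β]
    [MeasurableSpace γ] [StandardBorelSpace γ] [Nonempty γ] (μ : Measure α)
    [IsProbabilityMeasure μ] {T : α → β} (hT : Measurable T) (π : Measure (β × γ))
    [IsProbabilityMeasure π] (h : π.map Prod.fst = μ.map T) :
    ∃ ρ : Measure (α × γ), IsProbabilityMeasure ρ ∧ ρ.map Prod.fst = μ ∧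
      ρ.map (Prod.map T id) = π := by
  refine ⟨μ ⊗ₘ (π.condKernel.comap T hT), inferInstance, Measure.fst_compProd _ _, ?_⟩
  conv_rhs => rw [← π.disintegrate π.condKernel, Measure.fst, h]
  ext s hs
  have hmap : Measurable (Prod.map T (id : γ → γ)) := hT.prodMap measurable_id
  rw [Measure.map_apply hmap hs, Measure.compProd_apply (hmap hs), Measure.compProd_apply hs,
    lintegral_map (Kernel.measurable_kernel_prodMk_left hs) hT]
  rfl

namespace IsNorm

variable {n : ℕ} {nrm : Vec n → ℝ}

lemma continuous (h : IsNorm nrm) : Continuous nrm := by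
  rw [← continuousOn_univ]
  refine ConvexOn.continuousOn isOpen_univ ⟨convex_univ, fun x _ y _ a b ha hb _ ↦ ?_⟩
  calc nrm (a • x + b • y) ≤ nrm (a • x) + nrm (b • y) := h.2.2 _ _
    _ = a • nrm x + b • nrm y := by
      rw [h.2.1, h.2.1, abs_of_nonneg ha, abs_of_nonneg hb, smul_eq_mul, smul_eq_mul]

lemma smul_eq_of_sign (h : IsNorm nrm) {y : ℝ} (hy : y = 1 ∨ y = -1) (x : Vec n) :
    nrm (y • x) = nrm x := by
  rw [h.2.1]
  rcases hy with rfl | rfl <;> simp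

end IsNorm

section Sign

variable {n : ℕ} {nrm : Vec n → ℝ}

lemma onXi_iff_ae {F : Measure (ℝ × Vec n)} [IsProbabilityMeasure F] :
    OnXi F ↔ ∀ᵐ z ∂F, z.1 = 1 ∨ z.1 = -1 := by
  have hmeas : MeasurableSet {z : ℝ × Vec n | z.1 = 1 ∨ z.1 = -1} :=
    (measurable_fst (measurableSet_singleton 1)).union (measurable_fst (measurableSet_singleton _))
  exact (mem_ae_iff_prob_eq_one hmeas).symm

lemma smul_smul_self_of_sign {y : ℝ} (hy : y = 1 ∨ y = -1) (x : Vec n) : y • y • x = x := by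
  rcases hy with rfl | rfl <;> simp

lemma continuous_signed_smul : Continuous fun z : ℝ × Vec n ↦ z.1 • z.2 :=
  continuous_fst.smul continuous_snd

lemma hasMomentP_map_smul_iff (hnrm : IsNorm nrm) {p : ℝ≥0∞} (hp : p ≠ 0)
    {F : Measure (ℝ × Vec n)} [IsProbabilityMeasure F] (hF : OnXi F) :
    HasMomentP nrm p (F.map fun z ↦ z.1 • z.2) ↔ HasMomentP (fun z ↦ nrm z.2) p F := by
  have hmeas : Measurable fun x ↦ ENNReal.ofReal (nrm x) :=
    hnrm.continuous.measurable.ennreal_ofReal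
  rw [hasMomentP_iff_eLpNorm_ne_top _ hp, hasMomentP_iff_eLpNorm_ne_top _ hp,
    eLpNorm_map_measure hmeas.aestronglyMeasurable
      continuous_signed_smul.measurable.aemeasurable]
  rw [eLpNorm_congr_ae]
  filter_upwards [onXi_iff_ae.1 hF] with z hz
  simp [hnrm.smul_eq_of_sign hz]

lemma continuous_normCost (hnrm : IsNorm nrm) :
    Continuous fun z : Vec n × Vec n ↦ ENNReal.ofReal (nrm (z.1 - z.2)) :=
  ENNReal.continuous_ofReal.comp (hnrm.continuous.comp (continuous_fst.sub continuous_snd))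

lemma measurable_xiCost (hnrm : IsNorm nrm) :
    Measurable fun z : (ℝ × Vec n) × (ℝ × Vec n) ↦ xiCost nrm z.1 z.2 := by
  refine Measurable.ite (measurableSet_eq_fun (by fun_prop) (by fun_prop)) ?_ measurable_const
  have := hnrm.continuous.measurable
  fun_prop

lemma normCost_smul_le_xiCost (hnrm : IsNorm nrm) {z₁ z₂ : ℝ × Vec n}
    (h : z₁.1 = 1 ∨ z₁.1 = -1) :
    ENNReal.ofReal (nrm (z₁.1 • z₁.2 - z₂.1 • z₂.2)) ≤ xiCost nrm z₁ z₂ := by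
  unfold xiCost
  split_ifs with heq
  · rw [← heq, ← smul_sub, hnrm.smul_eq_of_sign h]
  · exact le_top

lemma xiCost_smul_eq_normCost (hnrm : IsNorm nrm) {z : ℝ × Vec n} (h : z.1 = 1 ∨ z.1 = -1)
    (v : Vec n) :
    xiCost nrm (z.1, z.1 • v) z = ENNReal.ofReal (nrm (v - z.1 • z.2)) := by
  rw [xiCost, if_pos rfl, ← hnrm.smul_eq_of_sign h (z.1 • v - z.2), smul_sub,
    smul_smul_self_of_sign h]

lemma WassersteinD_map_smul_le (hnrm : IsNorm nrm) {p : ℝ≥0∞} (hp : p ≠ 0)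
    {F F₀ : Measure (ℝ × Vec n)} [IsProbabilityMeasure F] (hF : OnXi F) :
    WassersteinD (fun x y ↦ ENNReal.ofReal (nrm (x - y))) p
      (F.map fun z ↦ z.1 • z.2) (F₀.map fun z ↦ z.1 • z.2) ≤
      WassersteinD (xiCost nrm) p F F₀ := by
  have hT : Measurable fun z : ℝ × Vec n ↦ z.1 • z.2 := continuous_signed_smul.measurable
  rw [WassersteinD_eq_iInf_eLpNorm _ hp, WassersteinD_eq_iInf_eLpNorm _ hp]
  refine le_iInf₂ fun π ⟨hπ, h₁, h₂⟩ ↦ ?_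
  have hTT := hT.prodMap hT
  have hmem : π.map (Prod.map (fun z : ℝ × Vec n ↦ z.1 • z.2) (fun z : ℝ × Vec n ↦ z.1 • z.2)) ∈
      Couplings (F.map fun z ↦ z.1 • z.2) (F₀.map fun z ↦ z.1 • z.2) := by
    refine ⟨Measure.isProbabilityMeasure_map hTT.aemeasurable, ?_, ?_⟩
    · rw [← h₁, Measure.map_map measurable_fst hTT, Measure.map_map hT measurable_fst]
      rfl
    · rw [← h₂, Measure.map_map measurable_snd hTT, Measure.map_map hT measurable_snd]
      rfl
  refine (iInf₂_le _ hmem).trans ?_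
  rw [eLpNorm_map_measure (continuous_normCost hnrm).measurable.aestronglyMeasurable
    hTT.aemeasurable]
  have hsign : ∀ᵐ z ∂π, z.1.1 = 1 ∨ z.1.1 = -1 := by
    refine ae_of_ae_map (p := fun z : ℝ × Vec n ↦ z.1 = 1 ∨ z.1 = -1)
      measurable_fst.aemeasurable ?_
    rw [h₁]
    exact onXi_iff_ae.1 hF
  refine eLpNorm_mono_enorm_ae ?_
  filter_upwards [hsign] with z hz
  simpa using normCost_smul_le_xiCost hnrm hz

/-- Every coupling of `μ` with the law of `Y₀ • X₀` lifts to a coupling on signed vectors of the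
same cost. -/
lemma exists_lift_coupling (hnrm : IsNorm nrm) (p : ℝ≥0∞)
    {F₀ : Measure (ℝ × Vec n)} [IsProbabilityMeasure F₀] (hF₀ : OnXi F₀)
    {μ : Measure (Vec n)} {π : Measure (Vec n × Vec n)}
    (hπ : π ∈ Couplings μ (F₀.map fun z ↦ z.1 • z.2)) :
    ∃ F : Measure (ℝ × Vec n), IsProbabilityMeasure F ∧ OnXi F ∧
      F.map (fun z ↦ z.1 • z.2) = μ ∧ ∃ ρ ∈ Couplings F F₀,
        eLpNorm (fun z ↦ xiCost nrm z.1 z.2) p ρ =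
          eLpNorm (fun z : Vec n × Vec n ↦ ENNReal.ofReal (nrm (z.1 - z.2))) p π := by
  obtain ⟨hπ, h₁, h₂⟩ := hπ
  have hT : Measurable fun z : ℝ × Vec n ↦ z.1 • z.2 := continuous_signed_smul.measurable
  have := Measure.isProbabilityMeasure_map (μ := π) (f := Prod.swap) measurable_swap.aemeasurable
  obtain ⟨ρ, hρ, hρ₁, hρ₂⟩ := exists_map_prodMap_eq F₀ hT (π.map Prod.swap)
    (by rw [← h₂, Measure.map_map measurable_fst measurable_swap]; rfl)
  have hsign : ∀ᵐ w ∂ρ, w.1.1 = 1 ∨ w.1.1 = -1 := by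
    refine ae_of_ae_map (p := fun z : ℝ × Vec n ↦ z.1 = 1 ∨ z.1 = -1)
      measurable_fst.aemeasurable ?_
    rw [hρ₁]
    exact onXi_iff_ae.1 hF₀
  have hπ_eq : π = (ρ.map (Prod.map (fun z : ℝ × Vec n ↦ z.1 • z.2) id)).map Prod.swap := by
    rw [hρ₂, Measure.map_map measurable_swap measurable_swap, Prod.swap_swap_eq, Measure.map_id]
  have hTid := hT.prodMap (measurable_id (α := Vec n))
  have hS : Measurable fun w : (ℝ × Vec n) × Vec n ↦ (w.1.1, w.1.1 • w.2) := by fun_prop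
  have hF := Measure.isProbabilityMeasure_map (μ := ρ) hS.aemeasurable
  refine ⟨ρ.map fun w ↦ (w.1.1, w.1.1 • w.2), hF, ?_, ?_,
    ρ.map fun w ↦ ((w.1.1, w.1.1 • w.2), w.1), ⟨?_, ?_, ?_⟩, ?_⟩
  · rw [onXi_iff_ae, ae_map_iff hS.aemeasurable]
    · exact hsign
    · exact (measurable_fst (measurableSet_singleton 1)).union
        (measurable_fst (measurableSet_singleton _))
  · rw [← h₁, Measure.map_map hT hS]
    rw [hπ_eq, Measure.map_map measurable_swap hTid,
      Measure.map_map measurable_fst (measurable_swap.comp hTid)]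
    refine Measure.map_congr ?_
    filter_upwards [hsign] with w hw
    simpa using smul_smul_self_of_sign hw w.2
  · exact Measure.isProbabilityMeasure_map (hS.prodMk measurable_fst).aemeasurable
  · rw [Measure.map_map measurable_fst (hS.prodMk measurable_fst)]
    rfl
  · rw [Measure.map_map measurable_snd (hS.prodMk measurable_fst)]
    exact hρ₁
  · have hcost := continuous_normCost hnrm
    rw [hπ_eq, Measure.map_map measurable_swap hTid,
      eLpNorm_map_measure hcost.measurable.aestronglyMeasurable
        (measurable_swap.comp hTid).aemeasurable,
      eLpNorm_map_measure (measurable_xiCost hnrm).aestronglyMeasurable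
        (hS.prodMk measurable_fst).aemeasurable]
    refine eLpNorm_congr_ae ?_
    filter_upwards [hsign] with w hw
    exact xiCost_smul_eq_normCost hnrm hw w.2

end Sign

/-- Theorem 2 of the paper, eq. (11): for `p ∈ [1,∞]`, `ε ≥ 0`, a Borel
probability distribution `F₀` on `Ξ = {-1,1} × ℝⁿ` with finite `p`-th moment, the set of laws
of `Y·X` as the law of `(Y,X)` ranges over `B̄_p(F₀,ε)` equals the type-`p` Wasserstein ball
`B_p(law of Y₀·X₀, ε)` on `ℝⁿ`. -/
theorem stmt0 {n : ℕ} (nrm : Vec n → ℝ) (hnrm : IsNorm nrm)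
    (p : ℝ≥0∞) (hp : 1 ≤ p) (ε : ℝ) (hε : 0 ≤ ε)
    (F₀ : Measure (ℝ × Vec n)) (hF₀ : IsProbabilityMeasure F₀) (hXi : OnXi F₀)
    (hmom : HasMomentP (fun z => nrm z.2) p F₀) :
    (fun F : Measure (ℝ × Vec n) => F.map (fun z : ℝ × Vec n => z.1 • z.2)) ''
        WballXi nrm p F₀ ε
      = WballVec nrm p (F₀.map (fun z : ℝ × Vec n => z.1 • z.2)) ε := by
  have hp₀ : p ≠ 0 := (zero_lt_one.trans_le hp).ne'
  have hT : Measurable fun z : ℝ × Vec n ↦ z.1 • z.2 := continuous_signed_smul.measurable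
  apply Subset.antisymm
  · rintro _ ⟨F, ⟨hF, hFXi, hFmom, hW⟩, rfl⟩
    exact ⟨Measure.isProbabilityMeasure_map hT.aemeasurable,
      (hasMomentP_map_smul_iff hnrm hp₀ hFXi).2 hFmom,
      (WassersteinD_map_smul_le hnrm hp₀ hFXi).trans hW⟩
  · rintro μ ⟨hμ, hμmom, hW⟩
    have := Measure.isProbabilityMeasure_map (μ := F₀) hT.aemeasurable
    obtain ⟨π, hπ, hcost⟩ := exists_mem_couplings_eLpNorm_eq_WassersteinD
      (cost := fun x y ↦ ENNReal.ofReal (nrm (x - y))) (continuous_normCost hnrm) hp₀ μ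
      (F₀.map fun z ↦ z.1 • z.2)
    obtain ⟨F, hF, hFXi, hFμ, ρ, hρ, hρcost⟩ := exists_lift_coupling hnrm p hXi hπ
    refine ⟨F, ⟨hF, hFXi, ?_, ?_⟩, hFμ⟩
    · rwa [← hasMomentP_map_smul_iff hnrm hp₀ hFXi, hFμ]
    · rw [WassersteinD_eq_iInf_eLpNorm _ hp₀]
      exact (iInf₂_le ρ hρ).trans ((hρcost.trans hcost).le.trans hW)
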